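/- Fix θ, σ > 0, x ∈ (0,π), and 0 < c < d. Let u : [c,d] → (Ω → ℝ) be a centered Gaussian process with covariance E[u(s)u(t)] = (σ²/(θπ)) Σ_{k=1}^∞ k^{−2} sin²(kx) ( e^{−θk²|t−s|} − e^{−θk²(t+s)} ), and set t_i := c + (d−c)i/n. Then the estimator σ̂²_{n,x} := √( (θπ/(3(d−c))) Σ_{i=1}^n ( u(t_i) − u(t_{i−1}) )⁴ ) converges in probability to σ² as n → ∞. -/

import Mathlib

open MeasureTheory ProbabilityTheory Real Filter

noncomputable section

/-- `u` is a centered Gaussian process on `S` with covariance function `C`: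
every finite linear combination of its values at points of `S` is a centered real
Gaussian with the corresponding variance. -/
def IsCenteredGaussianField {Ω : Type*} [MeasurableSpace Ω] (P : Measure Ω)
    (u : ℝ → Ω → ℝ) (S : Set ℝ) (C : ℝ → ℝ → ℝ) : Prop :=
  ∀ (n : ℕ) (x : Fin n → ℝ), (∀ i, x i ∈ S) → ∀ a : Fin n → ℝ,
    Measure.map (fun ω => ∑ i, a i * u (x i) ω) P
      = gaussianReal 0 (∑ i, ∑ j, a i * a j * C (x i) (x j)).toNNReal

/-- Temporal covariance, at a fixed spatial point `x`, of the solution of the stochastic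
heat equation `du − θΔu dt = σ dW` on `[0, π]` with zero initial and Dirichlet boundary
conditions:
`E[u(s)u(t)] = (σ²/(θπ)) Σ_{k≥1} k^{−2} sin²(kx)(e^{−θk²|t−s|} − e^{−θk²(t+s)})`. -/
def heatCovTime (θ σ x s t : ℝ) : ℝ :=
  (σ ^ 2 / (θ * π)) * ∑' k : ℕ,
    Real.sin (((k : ℝ) + 1) * x) ^ 2 / ((k : ℝ) + 1) ^ 2 *
      (Real.exp (-(θ * ((k : ℝ) + 1) ^ 2 * |t - s|)) -
        Real.exp (-(θ * ((k : ℝ) + 1) ^ 2 * (t + s))))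

theorem summable_exp_neg_mul_sq {a : ℝ} (ha : 0 < a) :
    Summable fun k : ℕ => Real.exp (-(a * ((k : ℝ) + 1) ^ 2)) := by
  have h1 : Summable fun k : ℕ => Real.exp (-a) * Real.exp (-a * k) := by
    apply Summable.mul_left
    have := Real.summable_exp_nat_mul_iff (a := -a)
    simpa [mul_comm] using this.2 (by linarith)
  refine h1.of_nonneg_of_le (fun k => (Real.exp_pos _).le) (fun k => ?_)
  rw [← Real.exp_add]
  apply Real.exp_le_exp.2
  have hk : (0 : ℝ) ≤ k := k.cast_nonneg
  nlinarith [mul_nonneg ha.le hk, mul_nonneg ha.le (mul_nonneg hk hk)]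

theorem abs_tsum_exp_neg_mul_sq_sub_le {a : ℝ} (ha : 0 < a) :
    |∑' k : ℕ, Real.exp (-(a * ((k : ℝ) + 1) ^ 2)) - √(π / a) / 2| ≤ 1 := by
  have anti : AntitoneOn (fun y : ℝ => Real.exp (-a * y ^ 2)) (Set.Ici 0) := by
    intro y hy z hz hyz
    apply Real.exp_le_exp.2
    have hy : 0 ≤ y := hy
    nlinarith [mul_le_mul_of_nonneg_left (pow_le_pow_left₀ hy hyz 2) ha.le]
  have integrable_gauss : IntegrableOn (fun y : ℝ => Real.exp (-a * y ^ 2)) (Set.Ioi 0) :=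
    (integrable_exp_neg_mul_sq ha).integrableOn
  have h1 := anti.tsum_add_one_le_integral integrable_gauss (fun t _ => (Real.exp_pos _).le)
  have hs := summable_exp_neg_mul_sq ha
  have hs' : Summable (fun n : ℕ => Real.exp (-a * (n : ℝ) ^ 2)) := by
    rw [← summable_nat_add_iff 1]
    simpa using hs
  have h2 := anti.integral_le_tsum hs' (fun t _ => (Real.exp_pos _).le)
  rw [hs'.tsum_eq_zero_add] at h2
  rw [integral_gaussian_Ioi] at h1 h2
  simp only [Nat.cast_add, Nat.cast_one, neg_mul, Nat.cast_zero] at h1 h2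
  norm_num at h2
  rw [abs_le]
  constructor <;> linarith

theorem abs_sum_mul_sub_le_of_antitone {f s : ℕ → ℝ} (hf : Antitone f) (hf0 : ∀ k, 0 ≤ f k)
    (hs : ∀ k, |s k| ≤ 1) (N : ℕ) :
    |∑ k ∈ Finset.range N, f k * (s (k + 1) - s k)| ≤ 2 * f 0 := by
  have key : |∑ k ∈ Finset.range N, f k * (s (k + 1) - s k) - f N * s N| ≤ 2 * f 0 - f N := by
    induction N with
    | zero =>
      have := mul_le_mul_of_nonneg_left (hs 0) (hf0 0)
      simp only [Finset.range_zero, Finset.sum_empty, zero_sub, abs_neg, abs_mul,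
        abs_of_nonneg (hf0 0)]
      linarith
    | succ n ih =>
      have h1 : f (n + 1) ≤ f n := hf n.le_succ
      have h2 : |(f n - f (n + 1)) * s (n + 1)| ≤ f n - f (n + 1) := by
        rw [abs_mul, abs_of_nonneg (sub_nonneg.2 h1)]
        exact mul_le_of_le_one_right (sub_nonneg.2 h1) (hs _)
      have h3 := abs_add_le (∑ k ∈ Finset.range n, f k * (s (k + 1) - s k) - f n * s n)
        ((f n - f (n + 1)) * s (n + 1))
      rw [Finset.sum_range_succ]
      calc _ = |∑ k ∈ Finset.range n, f k * (s (k + 1) - s k) - f n * s n +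
            (f n - f (n + 1)) * s (n + 1)| := by congr 1; ring
        _ ≤ _ := by linarith
  have h4 : |f N * s N| ≤ f N := by
    rw [abs_mul, abs_of_nonneg (hf0 N)]
    exact mul_le_of_le_one_right (hf0 N) (hs _)
  have h5 := abs_add_le (∑ k ∈ Finset.range N, f k * (s (k + 1) - s k) - f N * s N) (f N * s N)
  rw [sub_add_cancel] at h5
  linarith

theorem abs_tsum_cos_mul_exp_le {a x : ℝ} (ha : 0 < a) (hx : 0 < Real.sin x) :
    |∑' k : ℕ, Real.cos (2 * (((k : ℝ) + 1) * x)) * Real.exp (-(a * ((k : ℝ) + 1) ^ 2))|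
      ≤ 1 / Real.sin x := by
  have hsum : Summable fun k : ℕ =>
      Real.cos (2 * (((k : ℝ) + 1) * x)) * Real.exp (-(a * ((k : ℝ) + 1) ^ 2)) := by
    refine (summable_exp_neg_mul_sq ha).of_norm_bounded (fun k => ?_)
    rw [norm_mul, Real.norm_eq_abs, Real.norm_eq_abs, Real.abs_exp]
    exact mul_le_of_le_one_left (Real.exp_pos _).le (Real.abs_cos_le_one _)
  refine le_of_tendsto hsum.hasSum.tendsto_sum_nat.abs (Eventually.of_forall fun N => ?_)
  have hanti : Antitone fun k : ℕ => Real.exp (-(a * ((k : ℝ) + 1) ^ 2)) := by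
    intro k l hkl
    have : (k : ℝ) ≤ l := by exact_mod_cast hkl
    dsimp only
    gcongr
  have h := abs_sum_mul_sub_le_of_antitone (s := fun k : ℕ => Real.sin ((2 * (k : ℝ) + 1) * x))
    hanti (fun _ => (Real.exp_pos _).le) (fun _ => Real.abs_sin_le_one _) N
  have h0 : Real.exp (-(a * (((0 : ℕ) : ℝ) + 1) ^ 2)) ≤ 1 := Real.exp_le_one_iff.2 (by
    norm_num; exact ha.le)
  have heq : ∑ k ∈ Finset.range N, Real.exp (-(a * ((k : ℝ) + 1) ^ 2)) *
      (Real.sin ((2 * ((k + 1 : ℕ) : ℝ) + 1) * x) - Real.sin ((2 * (k : ℝ) + 1) * x)) =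
      (2 * Real.sin x) * ∑ k ∈ Finset.range N,
        Real.cos (2 * (((k : ℝ) + 1) * x)) * Real.exp (-(a * ((k : ℝ) + 1) ^ 2)) := by
    rw [Finset.mul_sum]
    refine Finset.sum_congr rfl fun k _ => ?_
    have e1 : (2 * ((k + 1 : ℕ) : ℝ) + 1) * x = 2 * (((k : ℝ) + 1) * x) + x := by push_cast; ring
    have e2 : (2 * (k : ℝ) + 1) * x = 2 * (((k : ℝ) + 1) * x) - x := by ring
    rw [e1, e2, Real.sin_add, Real.sin_sub]
    ring
  rw [heq, abs_mul, abs_of_pos (by positivity : 0 < 2 * Real.sin x)] at h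
  rw [le_div_iff₀ hx]
  nlinarith

theorem summable_sin_sq_mul_exp {a : ℝ} (x : ℝ) (ha : 0 < a) :
    Summable fun k : ℕ =>
      Real.sin (((k : ℝ) + 1) * x) ^ 2 * Real.exp (-(a * ((k : ℝ) + 1) ^ 2)) :=
  (summable_exp_neg_mul_sq ha).of_nonneg_of_le
    (fun _ => mul_nonneg (sq_nonneg _) (Real.exp_pos _).le)
    (fun _ => mul_le_of_le_one_left (Real.exp_pos _).le (Real.sin_sq_le_one _))

theorem abs_tsum_sin_sq_mul_exp_sub_le {a x : ℝ} (ha : 0 < a) (hx : 0 < Real.sin x) :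
    |2 * ∑' k : ℕ, Real.sin (((k : ℝ) + 1) * x) ^ 2 * Real.exp (-(a * ((k : ℝ) + 1) ^ 2))
      - √(π / a) / 2| ≤ 1 + 1 / Real.sin x := by
  have hs := summable_exp_neg_mul_sq ha
  have hsum : Summable fun k : ℕ =>
      Real.cos (2 * (((k : ℝ) + 1) * x)) * Real.exp (-(a * ((k : ℝ) + 1) ^ 2)) := by
    refine hs.of_norm_bounded (fun k => ?_)
    rw [norm_mul, Real.norm_eq_abs, Real.norm_eq_abs, Real.abs_exp]
    exact mul_le_of_le_one_left (Real.exp_pos _).le (Real.abs_cos_le_one _)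
  have e : 2 * ∑' k : ℕ, Real.sin (((k : ℝ) + 1) * x) ^ 2 * Real.exp (-(a * ((k : ℝ) + 1) ^ 2))
      = ∑' k : ℕ, Real.exp (-(a * ((k : ℝ) + 1) ^ 2)) - ∑' k : ℕ,
        Real.cos (2 * (((k : ℝ) + 1) * x)) * Real.exp (-(a * ((k : ℝ) + 1) ^ 2)) := by
    rw [← hs.tsum_sub hsum, ← tsum_mul_left]
    refine tsum_congr fun k => ?_
    rw [Real.cos_two_mul, Real.cos_sq']
    ring
  have h1 := abs_le.1 (abs_tsum_exp_neg_mul_sq_sub_le ha)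
  have h2 := abs_le.1 (abs_tsum_cos_mul_exp_le ha hx)
  rw [e, abs_le]
  constructor <;> linarith [h1.1, h1.2, h2.1, h2.2]

theorem integral_exp_neg_mul {m A : ℝ} (hm : 0 < m) (hA : 0 ≤ A) :
    ∫ a in Set.Ioc 0 A, Real.exp (-(a * m)) = (1 - Real.exp (-(A * m))) / m := by
  rw [← intervalIntegral.integral_of_le hA]
  have hd : ∀ t ∈ Set.uIcc 0 A,
      HasDerivAt (fun a => -Real.exp (-(a * m)) / m) (Real.exp (-(t * m))) t := by
    intro t _
    have h := (((hasDerivAt_id t).mul_const m).neg.exp.neg).div_const m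
    convert! h using 1
    simp only [id, Pi.neg_apply]
    field_simp
  rw [intervalIntegral.integral_eq_sub_of_hasDerivAt hd
    (Continuous.intervalIntegrable (by fun_prop) _ _)]
  simp
  ring

theorem summable_one_div_succ_sq : Summable fun k : ℕ => 1 / ((k : ℝ) + 1) ^ 2 := by
  have := (summable_nat_add_iff 1).2 (Real.summable_one_div_nat_pow.2 (by norm_num : 1 < 2))
  simpa using this

theorem integral_sqrt_pi_div {A : ℝ} (hA : 0 ≤ A) :
    IntegrableOn (fun a => √(π / a) / 2) (Set.Ioc 0 A) ∧
      ∫ a in Set.Ioc 0 A, √(π / a) / 2 = √(π * A) := by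
  have hI := intervalIntegral.intervalIntegrable_rpow' (a := 0) (b := A)
    (by norm_num : (-1 : ℝ) < -(1 / 2))
  have heq : Set.EqOn (fun a : ℝ => √π / 2 * a ^ (-(1 / 2) : ℝ)) (fun a => √(π / a) / 2)
      (Set.Ioc 0 A) := by
    intro a ha
    have : a ^ (-(1 / 2) : ℝ) = (√a)⁻¹ := by rw [Real.rpow_neg ha.1.le, ← Real.sqrt_eq_rpow]
    simp only [this, Real.sqrt_div Real.pi_pos.le]
    ring
  rw [intervalIntegrable_iff_integrableOn_Ioc_of_le hA] at hI
  refine ⟨IntegrableOn.congr_fun (hI.const_mul _) heq measurableSet_Ioc, ?_⟩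
  rw [← setIntegral_congr_fun measurableSet_Ioc heq, integral_const_mul,
    ← intervalIntegral.integral_of_le hA, integral_rpow (Or.inl (by norm_num)),
    Real.sqrt_mul Real.pi_pos.le, Real.sqrt_eq_rpow A]
  norm_num
  ring

theorem abs_tsum_sin_sq_div_mul_one_sub_exp_sub_le {A x : ℝ} (hA : 0 ≤ A) (hx : 0 < Real.sin x) :
    |2 * ∑' k : ℕ, Real.sin (((k : ℝ) + 1) * x) ^ 2 / ((k : ℝ) + 1) ^ 2 *
        (1 - Real.exp (-(A * ((k : ℝ) + 1) ^ 2))) - √(π * A)| ≤ (1 + 1 / Real.sin x) * A := by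
  set F : ℕ → ℝ → ℝ := fun k a =>
    Real.sin (((k : ℝ) + 1) * x) ^ 2 * Real.exp (-(a * ((k : ℝ) + 1) ^ 2)) with hF
  have hFnn : ∀ k a, 0 ≤ F k a := fun k a => mul_nonneg (sq_nonneg _) (Real.exp_pos _).le
  have hFc : ∀ k, Continuous (F k) := fun k => by fun_prop
  have hFi : ∀ k, ∫ a in Set.Ioc 0 A, F k a =
      Real.sin (((k : ℝ) + 1) * x) ^ 2 / ((k : ℝ) + 1) ^ 2 *
        (1 - Real.exp (-(A * ((k : ℝ) + 1) ^ 2))) := by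
    intro k
    simp only [hF]
    rw [integral_const_mul, integral_exp_neg_mul (by positivity) hA]
    ring
  have integrable_gauss : ∀ k, Integrable (F k) (volume.restrict (Set.Ioc 0 A)) := fun k =>
    ((hFc k).integrableOn_Icc (a := 0) (b := A)).mono_set Set.Ioc_subset_Icc_self
  have hsumm : Summable fun k => ∫ a in Set.Ioc 0 A, ‖F k a‖ := by
    simp only [Real.norm_eq_abs, abs_of_nonneg (hFnn _ _), hFi]
    refine summable_one_div_succ_sq.of_nonneg_of_le (fun k => ?_) (fun k => ?_)
    · refine mul_nonneg (by positivity) (sub_nonneg.2 (Real.exp_le_one_iff.2 ?_))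
      rw [neg_nonpos]; positivity
    · refine (mul_le_of_le_one_right (by positivity) ?_).trans ?_
      · linarith [Real.exp_pos (-(A * ((k : ℝ) + 1) ^ 2))]
      · gcongr
        exact Real.sin_sq_le_one _
  have hS := (hasSum_integral_of_summable_integral_norm integrable_gauss hsumm).tsum_eq
  simp only [hFi] at hS
  obtain ⟨hq, hq'⟩ := integral_sqrt_pi_div hA
  have hb : ∀ a ∈ Set.Ioc 0 A, ‖2 * ∑' k, F k a - √(π / a) / 2‖ ≤ 1 + 1 / Real.sin x :=
    fun a ha => abs_tsum_sin_sq_mul_exp_sub_le ha.1 hx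
  have hmeas : AEStronglyMeasurable (fun a => ∑' k, F k a) (volume.restrict (Set.Ioc 0 A)) := by
    refine aestronglyMeasurable_of_tendsto_ae atTop
      (f := fun N a => ∑ k ∈ Finset.range N, F k a) (fun N => ?_) ?_
    · exact (continuous_finsetSum _ fun k _ => hFc k).aestronglyMeasurable
    · filter_upwards [ae_restrict_mem measurableSet_Ioc] with a ha
      exact (summable_sin_sq_mul_exp x ha.1).hasSum.tendsto_sum_nat
  have hfin : volume (Set.Ioc 0 A) < ⊤ := measure_Ioc_lt_top
  have hd : IntegrableOn (fun a => 2 * ∑' k, F k a - √(π / a) / 2) (Set.Ioc 0 A) := by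
    refine Integrable.mono' (g := fun _ => 1 + 1 / Real.sin x)
      (integrableOn_const hfin.ne) ((hmeas.const_mul 2).sub hq.1) ?_
    filter_upwards [ae_restrict_mem measurableSet_Ioc] with a ha using hb a ha
  have hSi : ∫ a in Set.Ioc 0 A, (2 * ∑' k, F k a - √(π / a) / 2) =
      2 * (∫ a in Set.Ioc 0 A, ∑' k, F k a) - √(π * A) := by
    have hsi : IntegrableOn (fun a => 2 * ∑' k, F k a) (Set.Ioc 0 A) := by
      simpa [Pi.add_def] using hd.add hq
    rw [integral_sub hsi hq, hq', integral_const_mul]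
  have := norm_setIntegral_le_of_norm_le_const hfin hb
  rw [hSi, ← hS] at this
  simpa [Real.norm_eq_abs, hA] using this

/-- The stationary part of the temporal covariance of the stochastic heat equation, up to a
multiplicative constant, as a function of the time lag. -/
def heatKernelSeries (θ x t : ℝ) : ℝ :=
  ∑' k : ℕ, Real.sin (((k : ℝ) + 1) * x) ^ 2 / ((k : ℝ) + 1) ^ 2 *
    Real.exp (-(θ * ((k : ℝ) + 1) ^ 2 * t))

theorem sin_sq_div_le (x : ℝ) (k : ℕ) :
    Real.sin (((k : ℝ) + 1) * x) ^ 2 / ((k : ℝ) + 1) ^ 2 ≤ 1 / ((k : ℝ) + 1) ^ 2 := by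
  gcongr
  exact Real.sin_sq_le_one _

theorem summable_heatKernelSeries {θ t : ℝ} (x : ℝ) (hθ : 0 ≤ θ) (ht : 0 ≤ t) :
    Summable fun k : ℕ => Real.sin (((k : ℝ) + 1) * x) ^ 2 / ((k : ℝ) + 1) ^ 2 *
      Real.exp (-(θ * ((k : ℝ) + 1) ^ 2 * t)) := by
  refine summable_one_div_succ_sq.of_nonneg_of_le (fun k => by positivity) (fun k => ?_)
  refine (mul_le_of_le_one_right (by positivity) ?_).trans (sin_sq_div_le x k)
  rw [Real.exp_le_one_iff, neg_nonpos]
  positivity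

theorem heatCovTime_eq {θ s t : ℝ} (σ x : ℝ) (hθ : 0 ≤ θ) (hs : 0 ≤ s) (ht : 0 ≤ t) :
    heatCovTime θ σ x s t = σ ^ 2 / (θ * π) *
      (heatKernelSeries θ x |t - s| - heatKernelSeries θ x (t + s)) := by
  unfold heatCovTime heatKernelSeries
  rw [← (summable_heatKernelSeries x hθ (abs_nonneg _)).tsum_sub
    (summable_heatKernelSeries x hθ (add_nonneg ht hs))]
  simp only [mul_sub]

theorem heatCovTime_comm (θ σ x s t : ℝ) : heatCovTime θ σ x s t = heatCovTime θ σ x t s := by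
  simp only [heatCovTime, abs_sub_comm t s, add_comm t s]

theorem two_mul_heatKernelSeries_le {θ t h : ℝ} (x : ℝ) (hθ : 0 ≤ θ) (ht : 0 ≤ t) (hh : 0 ≤ h) :
    2 * heatKernelSeries θ x (t + h) ≤
      heatKernelSeries θ x t + heatKernelSeries θ x (t + 2 * h) := by
  have s0 := summable_heatKernelSeries x hθ ht
  have s1 := summable_heatKernelSeries x hθ (add_nonneg ht hh)
  have s2 := summable_heatKernelSeries x hθ (by positivity : 0 ≤ t + 2 * h)
  unfold heatKernelSeries
  rw [← tsum_mul_left, ← s0.tsum_add s2]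
  refine (s1.mul_left 2).tsum_le_tsum (fun k => ?_) (s0.add s2)
  have e1 : Real.exp (-(θ * ((k : ℝ) + 1) ^ 2 * (t + h))) =
      Real.exp (-(θ * ((k : ℝ) + 1) ^ 2 * t)) * Real.exp (-(θ * ((k : ℝ) + 1) ^ 2 * h)) := by
    rw [← Real.exp_add]; ring_nf
  have e2 : Real.exp (-(θ * ((k : ℝ) + 1) ^ 2 * (t + 2 * h))) =
      Real.exp (-(θ * ((k : ℝ) + 1) ^ 2 * t)) *
        Real.exp (-(θ * ((k : ℝ) + 1) ^ 2 * h)) ^ 2 := by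
    rw [← Real.exp_nat_mul, ← Real.exp_add]; push_cast; ring_nf
  rw [e1, e2]
  have : 0 ≤ Real.sin (((k : ℝ) + 1) * x) ^ 2 / ((k : ℝ) + 1) ^ 2 *
      Real.exp (-(θ * ((k : ℝ) + 1) ^ 2 * t)) := by positivity
  nlinarith [mul_nonneg this (sq_nonneg (1 - Real.exp (-(θ * ((k : ℝ) + 1) ^ 2 * h))))]

theorem exp_neg_mul_sub_exp_neg_mul_le {m s t : ℝ} (hs : 0 < s) (hst : s ≤ t) :
    Real.exp (-(m * s)) - Real.exp (-(m * t)) ≤ (t - s) / s := by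
  have h1 : Real.exp (-(m * t)) = Real.exp (-(m * s)) * Real.exp (-(m * (t - s))) := by
    rw [← Real.exp_add]; ring_nf
  have h2 := Real.add_one_le_exp (-(m * (t - s)))
  have h3 : m * s * Real.exp (-(m * s)) ≤ 1 := by
    have h4 := Real.add_one_le_exp (m * s)
    have h5 : Real.exp (m * s) * Real.exp (-(m * s)) = 1 := by rw [← Real.exp_add]; simp
    nlinarith [Real.exp_pos (-(m * s))]
  rw [le_div_iff₀ hs, h1]
  have h6 := mul_le_mul_of_nonneg_left h2 (mul_pos (Real.exp_pos (-(m * s))) hs).le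
  have h7 := mul_le_mul_of_nonneg_left h3 (sub_nonneg.2 hst)
  nlinarith

theorem heatKernelSeries_sub_mem_Icc {θ s t : ℝ} (x : ℝ) (hθ : 0 ≤ θ) (hs : 0 < s) (hst : s ≤ t) :
    heatKernelSeries θ x s - heatKernelSeries θ x t ∈
      Set.Icc 0 ((∑' k : ℕ, 1 / ((k : ℝ) + 1) ^ 2) * ((t - s) / s)) := by
  have s0 := summable_heatKernelSeries x hθ hs.le
  have s1 := summable_heatKernelSeries x hθ (hs.le.trans hst)
  unfold heatKernelSeries
  rw [← s0.tsum_sub s1, ← tsum_mul_right]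
  refine ⟨tsum_nonneg fun k => ?_, (s0.sub s1).tsum_le_tsum (fun k => ?_)
    (summable_one_div_succ_sq.mul_right _)⟩
  · rw [← mul_sub]
    refine mul_nonneg (by positivity) (sub_nonneg.2 (Real.exp_le_exp.2 ?_))
    gcongr
  · rw [← mul_sub]
    have h : 0 ≤ (t - s) / s := div_nonneg (sub_nonneg.2 hst) hs.le
    calc _ ≤ Real.sin (((k : ℝ) + 1) * x) ^ 2 / ((k : ℝ) + 1) ^ 2 * ((t - s) / s) := by
          gcongr
          exact exp_neg_mul_sub_exp_neg_mul_le hs hst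
      _ ≤ _ := mul_le_mul_of_nonneg_right (sin_sq_div_le x k) h

theorem abs_heatKernelSeries_zero_sub_le {θ h x : ℝ} (hθ : 0 ≤ θ) (hh : 0 ≤ h)
    (hx : 0 < Real.sin x) :
    |2 * (heatKernelSeries θ x 0 - heatKernelSeries θ x h) - √(π * (θ * h))| ≤
      (1 + 1 / Real.sin x) * (θ * h) := by
  have s0 := summable_heatKernelSeries x hθ le_rfl
  have s1 := summable_heatKernelSeries x hθ hh
  have key := abs_tsum_sin_sq_div_mul_one_sub_exp_sub_le (mul_nonneg hθ hh) hx
  unfold heatKernelSeries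
  rw [← s0.tsum_sub s1]
  convert! key using 4
  refine tsum_congr fun k => ?_
  rw [← mul_sub, mul_zero, neg_zero, Real.exp_zero]
  ring_nf

/-- The covariance of the increments over `[s, s']` and `[t, t']` of a centered process with
covariance function `C`. -/
def incrementCov (C : ℝ → ℝ → ℝ) (s s' t t' : ℝ) : ℝ :=
  C s' t' - C s' t - C s t' + C s t

theorem incrementCov_heatCovTime_nonpos {θ s t h : ℝ} (σ x : ℝ) (hθ : 0 < θ) (hs : 0 ≤ s)
    (hh : 0 ≤ h) (hst : s + h ≤ t) :
    incrementCov (heatCovTime θ σ x) s (s + h) t (t + h) ≤ 0 := by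
  have ht : 0 ≤ t := by linarith
  unfold incrementCov
  rw [heatCovTime_eq σ x hθ.le (by linarith) (by linarith), heatCovTime_eq σ x hθ.le
    (by linarith) (by linarith), heatCovTime_eq σ x hθ.le (by linarith) (by linarith),
    heatCovTime_eq σ x hθ.le (by linarith) (by linarith)]
  rw [abs_of_nonneg (by linarith), abs_of_nonneg (by linarith), abs_of_nonneg (by linarith),
    abs_of_nonneg (by linarith)]
  have h1 := two_mul_heatKernelSeries_le x hθ.le (sub_nonneg.2 hst) hh
  have h2 := two_mul_heatKernelSeries_le x hθ.le (add_nonneg ht hs) hh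
  rw [show t - (s + h) + h = t - s by ring, show t - (s + h) + 2 * h = t + h - s by ring] at h1
  rw [show t + h - (s + h) = t - s by ring, show t + h + (s + h) = t + s + 2 * h by ring,
    show t + (s + h) = t + s + h by ring, show t + h + s = t + s + h by ring]
  have hκ : 0 ≤ σ ^ 2 / (θ * π) := by positivity
  nlinarith

theorem exists_abs_incrementCov_heatCovTime_sub_le {θ x c : ℝ} (σ : ℝ) (hθ : 0 < θ)
    (hx : 0 < Real.sin x) (hc : 0 < c) :
    ∃ K, 0 ≤ K ∧ ∀ s h, c ≤ s → 0 ≤ h →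
      |incrementCov (heatCovTime θ σ x) s (s + h) s (s + h) - σ ^ 2 / √(θ * π) * √h| ≤ K * h := by
  set Z := ∑' k : ℕ, 1 / ((k : ℝ) + 1) ^ 2
  have hZ : 0 ≤ Z := tsum_nonneg fun k => by positivity
  have hκ : 0 ≤ σ ^ 2 / (θ * π) := by positivity
  refine ⟨σ ^ 2 / (θ * π) * ((1 + 1 / Real.sin x) * θ + Z / c), by positivity, ?_⟩
  intro s h hs hh
  have hs0 : 0 < s := hc.trans_le hs
  have h1 := abs_le.1 (abs_heatKernelSeries_zero_sub_le hθ.le hh hx)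
  have h2 := heatKernelSeries_sub_mem_Icc x hθ.le (by positivity : 0 < s + s)
    (by linarith : s + s ≤ s + s + h)
  have h3 := (heatKernelSeries_sub_mem_Icc x hθ.le (by positivity : 0 < s + s + h)
    (by linarith : s + s + h ≤ s + s + 2 * h)).1
  have h4 := two_mul_heatKernelSeries_le x hθ.le (by positivity : 0 ≤ s + s) hh
  have h5 : Z * ((s + s + h - (s + s)) / (s + s)) ≤ Z / c * h := by
    rw [div_mul_eq_mul_div, ← mul_div_assoc]
    have : Z * (s + s + h - (s + s)) = Z * h := by ring
    rw [this]
    exact div_le_div_of_nonneg_left (by positivity) hc (by linarith)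
  have h6 := h2.2.trans h5
  have hv : σ ^ 2 / √(θ * π) * √h = σ ^ 2 / (θ * π) * √(π * (θ * h)) := by
    rw [show π * (θ * h) = (θ * π) * h by ring, Real.sqrt_mul (by positivity : 0 ≤ θ * π) h]
    have hp : 0 < θ * π := by positivity
    have hq : 0 < √(θ * π) := Real.sqrt_pos.2 hp
    have : θ * π = √(θ * π) * √(θ * π) := (Real.mul_self_sqrt hp.le).symm
    rw [div_mul_eq_mul_div, div_mul_eq_mul_div, div_eq_div_iff hq.ne' hp.ne']
    linear_combination (σ ^ 2 * √h) * this
  unfold incrementCov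
  rw [heatCovTime_comm θ σ x (s + h) s,
    heatCovTime_eq σ x hθ.le (by linarith) (by linarith), heatCovTime_eq σ x hθ.le
    (by linarith) (by linarith), heatCovTime_eq σ x hθ.le (by linarith) (by linarith), hv]
  rw [abs_of_nonneg (by linarith : 0 ≤ s + h - s), sub_self, sub_self, abs_zero,
    add_sub_cancel_left, show s + h + (s + h) = s + s + 2 * h by ring,
    show s + h + s = s + s + h by ring]
  set E := heatKernelSeries θ x
  have e : σ ^ 2 / (θ * π) * (E 0 - E (s + s + 2 * h)) - σ ^ 2 / (θ * π) * (E h - E (s + s + h))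
      - σ ^ 2 / (θ * π) * (E h - E (s + s + h)) + σ ^ 2 / (θ * π) * (E 0 - E (s + s))
      - σ ^ 2 / (θ * π) * √(π * (θ * h)) = σ ^ 2 / (θ * π) * (2 * (E 0 - E h) - √(π * (θ * h))
        - (E (s + s) + E (s + s + 2 * h) - 2 * E (s + s + h))) := by ring
  rw [e, abs_mul, abs_of_nonneg hκ, mul_assoc]
  refine mul_le_mul_of_nonneg_left (abs_le.2 ⟨?_, ?_⟩) hκ
  · linarith [h1.1]
  · have : 0 ≤ Z / c * h := by positivity
    linarith [h1.2]

theorem iteratedDeriv_exp_mul_sq (v : ℝ) :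
    iteratedDeriv 2 (fun t : ℝ => Real.exp (v * t ^ 2 / 2)) 0 = v ∧
    iteratedDeriv 4 (fun t : ℝ => Real.exp (v * t ^ 2 / 2)) 0 = 3 * v ^ 2 ∧
    iteratedDeriv 8 (fun t : ℝ => Real.exp (v * t ^ 2 / 2)) 0 = 105 * v ^ 4 := by
  have hstep : ∀ p q : ℝ → ℝ, (∀ t, HasDerivAt p (q t - v * t * p t) t) →
      deriv (fun t => p t * Real.exp (v * t ^ 2 / 2)) =
        fun t => q t * Real.exp (v * t ^ 2 / 2) := by
    intro p q hp
    funext t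
    have h1 : HasDerivAt (fun t : ℝ => v * t ^ 2 / 2) (v * t) t := by
      have := ((hasDerivAt_pow 2 t).const_mul v).div_const 2
      convert! this using 1
      simp only [Nat.cast_ofNat]
      ring
    refine ((hp t).mul h1.exp).deriv.trans ?_
    ring
  have hpoly : ∀ p q : Polynomial ℝ, q = Polynomial.derivative p +
      Polynomial.C v * Polynomial.X * p →
      deriv (fun t => p.eval t * Real.exp (v * t ^ 2 / 2)) =
        fun t => q.eval t * Real.exp (v * t ^ 2 / 2) := by
    intro p q h
    refine hstep _ _ fun t => ?_
    convert! p.hasDerivAt t using 1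
    simp [h]
  have hiter : ∀ n, iteratedDeriv n (fun t : ℝ => Real.exp (v * t ^ 2 / 2)) =
      fun t => ((fun p => Polynomial.derivative p + Polynomial.C v * Polynomial.X * p)^[n]
        (1 : Polynomial ℝ)).eval t * Real.exp (v * t ^ 2 / 2) := by
    intro n
    induction n with
    | zero => simp
    | succ n ih =>
      rw [iteratedDeriv_succ, ih]
      refine hpoly _ _ ?_
      rw [Function.iterate_succ_apply']
  refine ⟨?_, ?_, ?_⟩ <;> rw [hiter] <;> simp [Function.iterate_succ_apply'] <;> ring

theorem integral_pow_gaussianReal (v : NNReal) :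
    ∫ y, y ^ 2 ∂gaussianReal 0 v = v ∧ ∫ y, y ^ 4 ∂gaussianReal 0 v = 3 * (v : ℝ) ^ 2 ∧
      ∫ y, y ^ 8 ∂gaussianReal 0 v = 105 * (v : ℝ) ^ 4 := by
  have h : ∀ n, ∫ y, y ^ n ∂gaussianReal 0 v =
      iteratedDeriv n (fun t : ℝ => Real.exp (v * t ^ 2 / 2)) 0 := by
    intro n
    have h1 := iteratedDeriv_mgf_zero (X := id) (μ := gaussianReal 0 v)
      (by rw [integrableExpSet_id_gaussianReal]; simp) n
    rw [mgf_id_gaussianReal] at h1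
    simpa using h1.symm
  simpa only [h] using iteratedDeriv_exp_mul_sq v

theorem aemeasurable_of_map_eq_gaussianReal {Ω : Type*} [MeasurableSpace Ω] {P : Measure Ω}
    {X : Ω → ℝ} {v : NNReal} (h : P.map X = gaussianReal 0 v) : AEMeasurable X P :=
  AEMeasurable.of_map_ne_zero (by rw [h]; exact IsProbabilityMeasure.ne_zero _)

theorem integral_pow_of_map_eq_gaussianReal {Ω : Type*} [MeasurableSpace Ω] {P : Measure Ω}
    {X : Ω → ℝ} {v : NNReal} (h : P.map X = gaussianReal 0 v) (n : ℕ) :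
    ∫ ω, X ω ^ n ∂P = ∫ y, y ^ n ∂gaussianReal 0 v := by
  rw [← h, integral_map (aemeasurable_of_map_eq_gaussianReal h)
    (by fun_prop)]

theorem integrable_pow_of_map_eq_gaussianReal {Ω : Type*} [MeasurableSpace Ω] {P : Measure Ω}
    {X : Ω → ℝ} {v : NNReal} (h : P.map X = gaussianReal 0 v) (n : ℕ) :
    Integrable (fun ω => X ω ^ n) P := by
  have h1 : Integrable (fun y : ℝ => y ^ n) (gaussianReal 0 v) :=
    integrable_pow_of_mem_interior_integrableExpSet (X := fun y => y)
      (by rw [integrableExpSet_fun_id_gaussianReal]; simp) n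
  rw [← h] at h1
  exact h1.comp_aemeasurable (aemeasurable_of_map_eq_gaussianReal h)

theorem integrable_pow_mul_pow_of_map_eq_gaussianReal {Ω : Type*} [MeasurableSpace Ω]
    {P : Measure Ω} {X Y : Ω → ℝ} {v w : NNReal} (hX : P.map X = gaussianReal 0 v)
    (hY : P.map Y = gaussianReal 0 w) (m n : ℕ) :
    Integrable (fun ω => X ω ^ m * Y ω ^ n) P := by
  have h : ∀ {X : Ω → ℝ} {v : NNReal} (_ : P.map X = gaussianReal 0 v) (m : ℕ),
      MemLp (fun ω => X ω ^ m) 2 P := by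
    intro X v hX m
    rw [memLp_two_iff_integrable_sq
      ((aemeasurable_of_map_eq_gaussianReal hX).pow_const m).aestronglyMeasurable]
    simpa only [← pow_mul] using integrable_pow_of_map_eq_gaussianReal hX (m * 2)
  exact (h hX m).integrable_mul (h hY n)

/-- The pair `(X, Y)` is centered jointly Gaussian. -/
def IsCenteredGaussianPair {Ω : Type*} [MeasurableSpace Ω] (P : Measure Ω) (X Y : Ω → ℝ) : Prop :=
  ∀ a b : ℝ, ∃ v : NNReal, P.map (fun ω => a * X ω + b * Y ω) = gaussianReal 0 v

namespace IsCenteredGaussianPair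

variable {Ω : Type*} [MeasurableSpace Ω] {P : Measure Ω} {X Y : Ω → ℝ}

theorem exists_map_left (h : IsCenteredGaussianPair P X Y) :
    ∃ v : NNReal, P.map X = gaussianReal 0 v := by
  simpa using h 1 0

theorem exists_map_right (h : IsCenteredGaussianPair P X Y) :
    ∃ v : NNReal, P.map Y = gaussianReal 0 v := by
  simpa using h 0 1

theorem integrable_pow_mul_pow (h : IsCenteredGaussianPair P X Y) (m n : ℕ) :
    Integrable (fun ω => X ω ^ m * Y ω ^ n) P := by
  obtain ⟨v, hv⟩ := h.exists_map_left
  obtain ⟨w, hw⟩ := h.exists_map_right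
  exact integrable_pow_mul_pow_of_map_eq_gaussianReal hv hw m n

theorem integrable_mul (h : IsCenteredGaussianPair P X Y) :
    Integrable (fun ω => X ω * Y ω) P := by
  simpa using h.integrable_pow_mul_pow 1 1

theorem integral_sq (h : IsCenteredGaussianPair P X Y) (a b : ℝ) :
    ∫ ω, (a * X ω + b * Y ω) ^ 2 ∂P =
      a ^ 2 * ∫ ω, X ω ^ 2 ∂P + 2 * a * b * ∫ ω, X ω * Y ω ∂P + b ^ 2 * ∫ ω, Y ω ^ 2 ∂P := by
  have i1 : Integrable (fun ω => X ω ^ 2) P := by simpa using h.integrable_pow_mul_pow 2 0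
  have i2 : Integrable (fun ω => Y ω ^ 2) P := by simpa using h.integrable_pow_mul_pow 0 2
  have e : (fun ω => (a * X ω + b * Y ω) ^ 2) = fun ω =>
      a ^ 2 * X ω ^ 2 + 2 * a * b * (X ω * Y ω) + b ^ 2 * Y ω ^ 2 := by
    funext ω; ring
  have i3 : Integrable (fun ω => a ^ 2 * X ω ^ 2 + 2 * a * b * (X ω * Y ω)) P :=
    (i1.const_mul _).add (h.integrable_mul.const_mul _)
  rw [e, integral_add i3 (i2.const_mul _), integral_add (i1.const_mul _) (h.integrable_mul.const_mul _)]
  simp only [integral_const_mul]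

theorem integral_pow_eight (h : IsCenteredGaussianPair P X Y) (a b : ℝ) :
    ∫ ω, (a * X ω + b * Y ω) ^ 8 ∂P =
      105 * (a ^ 2 * ∫ ω, X ω ^ 2 ∂P + 2 * a * b * ∫ ω, X ω * Y ω ∂P
        + b ^ 2 * ∫ ω, Y ω ^ 2 ∂P) ^ 4 := by
  obtain ⟨v, hv⟩ := h a b
  rw [← h.integral_sq, integral_pow_of_map_eq_gaussianReal hv,
    integral_pow_of_map_eq_gaussianReal hv, (integral_pow_gaussianReal v).1,
    (integral_pow_gaussianReal v).2.2]

theorem integral_pow_four (h : IsCenteredGaussianPair P X Y) :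
    ∫ ω, X ω ^ 4 ∂P = 3 * (∫ ω, X ω ^ 2 ∂P) ^ 2 := by
  obtain ⟨v, hv⟩ := h.exists_map_left
  rw [integral_pow_of_map_eq_gaussianReal hv,
    integral_pow_of_map_eq_gaussianReal hv, (integral_pow_gaussianReal v).1,
    (integral_pow_gaussianReal v).2.1]

/-- Isserlis' formula for the joint fourth moments of a centered Gaussian pair. -/
theorem integral_pow_four_mul_pow_four (h : IsCenteredGaussianPair P X Y) :
    ∫ ω, X ω ^ 4 * Y ω ^ 4 ∂P =
      9 * (∫ ω, X ω ^ 2 ∂P) ^ 2 * (∫ ω, Y ω ^ 2 ∂P) ^ 2 +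
      72 * (∫ ω, X ω ^ 2 ∂P) * (∫ ω, Y ω ^ 2 ∂P) * (∫ ω, X ω * Y ω ∂P) ^ 2 +
      24 * (∫ ω, X ω * Y ω ∂P) ^ 4 := by
  have hexp : ∀ b : ℝ, ∫ ω, (1 * X ω + b * Y ω) ^ 8 ∂P = ∑ k ∈ Finset.range 9,
      b ^ k * (Nat.choose 8 k : ℝ) * ∫ ω, X ω ^ (8 - k) * Y ω ^ k ∂P := by
    intro b
    simp only [← integral_const_mul]
    rw [← integral_finsetSum _ fun k _ => (h.integrable_pow_mul_pow _ _).const_mul _]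
    congr 1
    funext ω
    rw [add_comm, add_pow]
    refine Finset.sum_congr rfl fun k _ => ?_
    rw [mul_pow]
    ring
  have p1 := (hexp 1).symm.trans (h.integral_pow_eight 1 1)
  have m1 := (hexp (-1)).symm.trans (h.integral_pow_eight 1 (-1))
  have p2 := (hexp 2).symm.trans (h.integral_pow_eight 1 2)
  have m2 := (hexp (-2)).symm.trans (h.integral_pow_eight 1 (-2))
  have p3 := (hexp 3).symm.trans (h.integral_pow_eight 1 3)
  have m3 := (hexp (-3)).symm.trans (h.integral_pow_eight 1 (-3))
  have z0 := (hexp 0).symm.trans (h.integral_pow_eight 1 0)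
  have z1 := h.integral_pow_eight 0 1
  simp [Finset.sum_range_succ, Nat.choose] at p1 m1 p2 m2 p3 m3 z0 z1
  linear_combination (-39 / 10080) * (p1 + m1) + (12 / 10080) * (p2 + m2)
    + (-1 / 10080) * (p3 + m3) + (56 / 10080) * z0 + (7056 / 10080) * z1

theorem abs_integral_mul_le (h : IsCenteredGaussianPair P X Y) {B : ℝ}
    (hX : ∫ ω, X ω ^ 2 ∂P ≤ B) (hY : ∫ ω, Y ω ^ 2 ∂P ≤ B) : |∫ ω, X ω * Y ω ∂P| ≤ B := by
  have h1 := h.integral_sq 1 1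
  have h2 := h.integral_sq 1 (-1)
  have h3 : 0 ≤ ∫ ω, (1 * X ω + 1 * Y ω) ^ 2 ∂P := integral_nonneg fun ω => sq_nonneg _
  have h4 : 0 ≤ ∫ ω, (1 * X ω + (-1) * Y ω) ^ 2 ∂P := integral_nonneg fun ω => sq_nonneg _
  rw [abs_le]
  constructor <;> linarith

end IsCenteredGaussianPair

theorem IsCenteredGaussianPair.abs_covariance_pow_four_le {Ω : Type*} [MeasurableSpace Ω]
    {P : Measure Ω} [IsProbabilityMeasure P] {X Y : Ω → ℝ} (h : IsCenteredGaussianPair P X Y)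
    {B : ℝ} (hX : ∫ ω, X ω ^ 2 ∂P ≤ B) (hY : ∫ ω, Y ω ^ 2 ∂P ≤ B) :
    Integrable (fun ω => (X ω ^ 4 - 3 * (∫ ω, X ω ^ 2 ∂P) ^ 2) *
      (Y ω ^ 4 - 3 * (∫ ω, Y ω ^ 2 ∂P) ^ 2)) P ∧
    ∫ ω, (X ω ^ 4 - 3 * (∫ ω, X ω ^ 2 ∂P) ^ 2) * (Y ω ^ 4 - 3 * (∫ ω, Y ω ^ 2 ∂P) ^ 2) ∂P
      ≤ 96 * B ^ 3 * |∫ ω, X ω * Y ω ∂P| := by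
  have h' : IsCenteredGaussianPair P Y X := fun a b => by
    simpa only [add_comm] using h b a
  have hc := h.abs_integral_mul_le hX hY
  have hXY := h.integral_pow_four_mul_pow_four
  have hX4 := h.integral_pow_four
  have hY4 := h'.integral_pow_four
  have iXY := h.integrable_pow_mul_pow 4 4
  have iX : Integrable (fun ω => X ω ^ 4) P := by simpa using h.integrable_pow_mul_pow 4 0
  have iY : Integrable (fun ω => Y ω ^ 4) P := by simpa using h.integrable_pow_mul_pow 0 4
  have hV0 : 0 ≤ ∫ ω, X ω ^ 2 ∂P := integral_nonneg fun ω => sq_nonneg _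
  have hW0 : 0 ≤ ∫ ω, Y ω ^ 2 ∂P := integral_nonneg fun ω => sq_nonneg _
  set V := ∫ ω, X ω ^ 2 ∂P
  set W := ∫ ω, Y ω ^ 2 ∂P
  set c := ∫ ω, X ω * Y ω ∂P
  have e : (fun ω => (X ω ^ 4 - 3 * V ^ 2) * (Y ω ^ 4 - 3 * W ^ 2)) = fun ω =>
      X ω ^ 4 * Y ω ^ 4 - (3 * W ^ 2) * X ω ^ 4 - (3 * V ^ 2) * Y ω ^ 4 + 9 * V ^ 2 * W ^ 2 := by
    funext ω; ring
  have i1 : Integrable (fun ω => X ω ^ 4 * Y ω ^ 4 - (3 * W ^ 2) * X ω ^ 4) P :=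
    iXY.sub (iX.const_mul _)
  have i2 : Integrable (fun ω => X ω ^ 4 * Y ω ^ 4 - (3 * W ^ 2) * X ω ^ 4
    - (3 * V ^ 2) * Y ω ^ 4) P := i1.sub (iY.const_mul _)
  rw [e]
  refine ⟨i2.add (integrable_const _), ?_⟩
  rw [integral_add i2 (integrable_const _), integral_sub i1 (iY.const_mul _),
    integral_sub iXY (iX.const_mul _), integral_const_mul, integral_const_mul, hXY, hX4, hY4]
  have hB : 0 ≤ B := hV0.trans hX
  have hVW : V * W ≤ B ^ 2 := by rw [sq]; exact mul_le_mul hX hY hW0 hB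
  have hc2 : c ^ 2 ≤ B * |c| := by
    rw [← sq_abs, sq]; exact mul_le_mul_of_nonneg_right hc (abs_nonneg _)
  have hc2' : c ^ 2 ≤ B ^ 2 := by
    rw [← sq_abs]; exact pow_le_pow_left₀ (abs_nonneg _) hc 2
  have h1 : 72 * (V * W) + 24 * c ^ 2 ≤ 96 * B ^ 2 := by linarith
  simp only [integral_const, probReal_univ, smul_eq_mul]
  calc _ = (72 * (V * W) + 24 * c ^ 2) * c ^ 2 := by ring
    _ ≤ 96 * B ^ 2 * (B * |c|) := mul_le_mul h1 hc2 (sq_nonneg _) (by positivity)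
    _ = _ := by ring

/-- An `L²` bound for the fourth variation of a jointly Gaussian family whose distinct members
are nonpositively correlated. -/
theorem integral_sq_sum_pow_four_sub_le {Ω : Type*} [MeasurableSpace Ω]
    {P : Measure Ω} [IsProbabilityMeasure P] {ι : Type*} [DecidableEq ι] (s : Finset ι)
    {X : ι → Ω → ℝ} {B : ℝ}
    (hG : ∀ i ∈ s, ∀ j ∈ s, IsCenteredGaussianPair P (X i) (X j))
    (hneg : ∀ i ∈ s, ∀ j ∈ s, i ≠ j → ∫ ω, X i ω * X j ω ∂P ≤ 0)
    (hB : ∀ i ∈ s, ∫ ω, X i ω ^ 2 ∂P ≤ B) (hB0 : 0 ≤ B) :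
    Integrable (fun ω => (∑ i ∈ s, (X i ω ^ 4 - 3 * (∫ ω, X i ω ^ 2 ∂P) ^ 2)) ^ 2) P ∧
    ∫ ω, (∑ i ∈ s, (X i ω ^ 4 - 3 * (∫ ω, X i ω ^ 2 ∂P) ^ 2)) ^ 2 ∂P
      ≤ 192 * s.card * B ^ 4 := by
  have hsum : ∑ i ∈ s, ∑ j ∈ s, |∫ ω, X i ω * X j ω ∂P| ≤ 2 * (s.card * B) := by
    have h0 : 0 ≤ ∑ i ∈ s, ∑ j ∈ s, ∫ ω, X i ω * X j ω ∂P := by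
      have : ∑ i ∈ s, ∑ j ∈ s, ∫ ω, X i ω * X j ω ∂P = ∫ ω, (∑ i ∈ s, X i ω) ^ 2 ∂P := by
        simp only [sq, Finset.sum_mul_sum]
        rw [integral_finsetSum _ fun i hi => integrable_finsetSum _ fun j hj =>
          (hG i hi j hj).integrable_mul]
        exact Finset.sum_congr rfl fun i hi => (integral_finsetSum _ fun j hj =>
          (hG i hi j hj).integrable_mul).symm
      rw [this]
      exact integral_nonneg fun ω => sq_nonneg _
    have h1 : ∀ i ∈ s, ∀ j ∈ s, |∫ ω, X i ω * X j ω ∂P| =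
        (if i = j then 2 * ∫ ω, X i ω ^ 2 ∂P else 0) - ∫ ω, X i ω * X j ω ∂P := by
      intro i hi j hj
      split_ifs with hij
      · subst hij
        simp only [← sq]
        rw [abs_of_nonneg (integral_nonneg fun ω => sq_nonneg _)]
        ring
      · rw [abs_of_nonpos (hneg i hi j hj hij), zero_sub]
    rw [Finset.sum_congr rfl fun i hi => Finset.sum_congr rfl (h1 i hi)]
    simp only [Finset.sum_sub_distrib, Finset.sum_ite_eq]
    have h2 : ∑ i ∈ s, (if i ∈ s then 2 * ∫ ω, X i ω ^ 2 ∂P else 0) ≤ s.card * (2 * B) := by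
      rw [← nsmul_eq_mul]
      refine Finset.sum_le_card_nsmul _ _ _ fun i hi => ?_
      rw [if_pos hi]
      linarith [hB i hi]
    linarith
  simp only [sq (∑ i ∈ s, (X i _ ^ 4 - _)), Finset.sum_mul_sum]
  have hij := fun i (hi : i ∈ s) j (hj : j ∈ s) =>
    (hG i hi j hj).abs_covariance_pow_four_le (hB i hi) (hB j hj)
  have hi1 := fun i (hi : i ∈ s) => integrable_finsetSum s fun j hj => (hij i hi j hj).1
  refine ⟨integrable_finsetSum _ hi1, ?_⟩
  rw [integral_finsetSum _ hi1, Finset.sum_congr rfl fun i hi =>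
    integral_finsetSum s fun j hj => (hij i hi j hj).1]
  calc _ ≤ ∑ i ∈ s, ∑ j ∈ s, 96 * B ^ 3 * |∫ ω, X i ω * X j ω ∂P| :=
        Finset.sum_le_sum fun i hi => Finset.sum_le_sum fun j hj => (hij i hi j hj).2
    _ = 96 * B ^ 3 * ∑ i ∈ s, ∑ j ∈ s, |∫ ω, X i ω * X j ω ∂P| := by
        simp only [Finset.mul_sum]
    _ ≤ 96 * B ^ 3 * (2 * (s.card * B)) := by gcongr
    _ = _ := by ring

namespace IsCenteredGaussianField

variable {Ω : Type*} [MeasurableSpace Ω] {P : Measure Ω} {u : ℝ → Ω → ℝ} {S : Set ℝ}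
  {C : ℝ → ℝ → ℝ} {s s' t t' : ℝ}

theorem map_increments (hu : IsCenteredGaussianField P u S C) (hC : ∀ s t, C s t = C t s)
    (hs : s ∈ S) (hs' : s' ∈ S) (ht : t ∈ S) (ht' : t' ∈ S) (a b : ℝ) :
    P.map (fun ω => a * (u s' ω - u s ω) + b * (u t' ω - u t ω)) = gaussianReal 0
      (a ^ 2 * incrementCov C s s' s s' + 2 * a * b * incrementCov C s s' t t' +
        b ^ 2 * incrementCov C t t' t t').toNNReal := by
  have h := hu 4 ![s, s', t, t'] (by intro i; fin_cases i <;> assumption) ![-a, a, -b, b]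
  convert! h using 2
  · funext ω
    simp [Fin.sum_univ_four]
    ring
  · congr 1
    simp [Fin.sum_univ_four, incrementCov]
    rw [hC s s', hC t s, hC t s', hC t' s, hC t' s', hC t' t]
    ring

theorem isCenteredGaussianPair_increments (hu : IsCenteredGaussianField P u S C)
    (hC : ∀ s t, C s t = C t s) (hs : s ∈ S) (hs' : s' ∈ S) (ht : t ∈ S) (ht' : t' ∈ S) :
    IsCenteredGaussianPair P (fun ω => u s' ω - u s ω) (fun ω => u t' ω - u t ω) :=
  fun a b => ⟨_, hu.map_increments hC hs hs' ht ht' a b⟩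

theorem integral_sq_increments (hu : IsCenteredGaussianField P u S C)
    (hC : ∀ s t, C s t = C t s) (hs : s ∈ S) (hs' : s' ∈ S) (ht : t ∈ S) (ht' : t' ∈ S)
    (a b : ℝ) :
    ∫ ω, (a * (u s' ω - u s ω) + b * (u t' ω - u t ω)) ^ 2 ∂P =
      max (a ^ 2 * incrementCov C s s' s s' + 2 * a * b * incrementCov C s s' t t' +
        b ^ 2 * incrementCov C t t' t t') 0 := by
  have h := hu.map_increments hC hs hs' ht ht' a b
  rw [integral_pow_of_map_eq_gaussianReal h, (integral_pow_gaussianReal _).1,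
    Real.coe_toNNReal']

theorem integral_sq_increment (hu : IsCenteredGaussianField P u S C)
    (hC : ∀ s t, C s t = C t s) (hs : s ∈ S) (hs' : s' ∈ S) :
    ∫ ω, (u s' ω - u s ω) ^ 2 ∂P = max (incrementCov C s s' s s') 0 := by
  simpa using hu.integral_sq_increments hC hs hs' hs hs' 1 0

theorem integral_increment_mul_increment_nonpos (hu : IsCenteredGaussianField P u S C)
    (hC : ∀ s t, C s t = C t s) (hs : s ∈ S) (hs' : s' ∈ S) (ht : t ∈ S) (ht' : t' ∈ S)
    (h : incrementCov C s s' t t' ≤ 0) :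
    ∫ ω, (u s' ω - u s ω) * (u t' ω - u t ω) ∂P ≤ 0 := by
  have hp := hu.isCenteredGaussianPair_increments hC hs hs' ht ht'
  have h1 := (hp.integral_sq 1 1).symm.trans (hu.integral_sq_increments hC hs hs' ht ht' 1 1)
  have h2 := (hp.integral_sq 1 (-1)).symm.trans
    (hu.integral_sq_increments hC hs hs' ht ht' 1 (-1))
  have h3 : max (1 ^ 2 * incrementCov C s s' s s' + 2 * 1 * 1 * incrementCov C s s' t t' +
        1 ^ 2 * incrementCov C t t' t t') 0 ≤
      max (1 ^ 2 * incrementCov C s s' s s' + 2 * 1 * (-1) * incrementCov C s s' t t' +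
        (-1) ^ 2 * incrementCov C t t' t t') 0 := max_le_max (by linarith) le_rfl
  linarith

end IsCenteredGaussianField

theorem abs_sum_sq_sub_le {n : ℕ} {V : ℕ → ℝ} {β K r L : ℝ} (hβ : 0 ≤ β) (hK : 0 ≤ K)
    (hr : 0 ≤ r) (hL : n * r ^ 2 = L) (hV : ∀ i < n, |V i - β * r| ≤ K * r ^ 2) :
    |∑ i ∈ Finset.range n, 3 * V i ^ 2 - 3 * β ^ 2 * L| ≤ 3 * L * K * r * (2 * β + K * r) := by
  have h1 : ∑ i ∈ Finset.range n, 3 * V i ^ 2 - 3 * β ^ 2 * L =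
      ∑ i ∈ Finset.range n, 3 * (V i ^ 2 - (β * r) ^ 2) := by
    rw [← hL]
    simp only [mul_sub, Finset.sum_sub_distrib, Finset.sum_const, Finset.card_range, nsmul_eq_mul]
    ring
  rw [h1]
  have h2 : ∀ i ∈ Finset.range n, |3 * (V i ^ 2 - (β * r) ^ 2)| ≤
      3 * (K * r ^ 2 * (2 * (β * r) + K * r ^ 2)) := by
    intro i hi
    have h3 := hV i (Finset.mem_range.1 hi)
    have h4 : |V i + β * r| ≤ 2 * (β * r) + K * r ^ 2 := by
      have := abs_add_le (V i - β * r) (2 * (β * r))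
      rw [abs_of_nonneg (by positivity : 0 ≤ 2 * (β * r))] at this
      calc |V i + β * r| = |V i - β * r + 2 * (β * r)| := by congr 1; ring
        _ ≤ _ := by linarith
    rw [abs_mul, abs_of_pos (by norm_num : (0 : ℝ) < 3), sq_sub_sq, mul_comm (V i + β * r),
      abs_mul]
    gcongr
  calc _ ≤ _ := Finset.abs_sum_le_sum_abs _ _
    _ ≤ _ := Finset.sum_le_card_nsmul _ _ _ h2
    _ = _ := by
      rw [Finset.card_range, nsmul_eq_mul, ← hL]
      ring

/-- Convergence in probability from a vanishing integrable majorant of the squared error, passed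
through the square root. -/
theorem tendstoInMeasure_sqrt_of_sq_sub_le {Ω : Type*} [MeasurableSpace Ω] {P : Measure Ω}
    [IsProbabilityMeasure P] {Q : ℕ → Ω → ℝ} {m : ℝ} (hm : 0 < m) (hQ : ∀ n ω, 0 ≤ Q n ω)
    {R : ℕ → ℝ} (hR : Tendsto R atTop (nhds 0))
    (hG : ∀ᶠ n in atTop, ∃ G : Ω → ℝ, Integrable G P ∧ (∀ ω, (Q n ω - m ^ 2) ^ 2 ≤ G ω) ∧
      ∫ ω, G ω ∂P ≤ R n) :
    TendstoInMeasure P (fun n ω => √(Q n ω)) atTop (fun _ => m) := by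
  rw [tendstoInMeasure_iff_measureReal_dist]
  intro ε hε
  have hδ : 0 < (ε * m) ^ 2 := by positivity
  have hR' : Tendsto (fun n => R n / (ε * m) ^ 2) atTop (nhds 0) := by
    simpa using hR.div_const ((ε * m) ^ 2)
  refine tendsto_of_tendsto_of_tendsto_of_le_of_le' tendsto_const_nhds hR'
    (Eventually.of_forall fun n => measureReal_nonneg) (hG.mono fun n hn => ?_)
  obtain ⟨G, hGi, hGQ, hGR⟩ := hn
  rw [le_div_iff₀ hδ, mul_comm]
  refine le_trans ?_ hGR
  refine le_trans ?_ (mul_meas_ge_le_integral_of_nonneg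
    (ae_of_all _ fun ω => (sq_nonneg _).trans (hGQ ω)) hGi ((ε * m) ^ 2))
  refine mul_le_mul_of_nonneg_left (measureReal_mono fun ω hω => ?_) hδ.le
  have hω : ε ≤ |√(Q n ω) - m| := hω
  refine le_trans ?_ (hGQ ω)
  rw [← sq_abs (Q n ω - m ^ 2)]
  refine pow_le_pow_left₀ (by positivity) ?_ 2
  have hs := Real.sqrt_nonneg (Q n ω)
  have e : Q n ω - m ^ 2 = (√(Q n ω) - m) * (√(Q n ω) + m) := by
    nth_rw 1 [← Real.sq_sqrt (hQ n ω)]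
    ring
  rw [e, abs_mul, abs_of_pos (by positivity : 0 < √(Q n ω) + m)]
  exact mul_le_mul hω (by linarith) hm.le (abs_nonneg _)

/-- Consistency in probability of the volatility estimator `σ̂²_{n,x}` built from the
temporal fourth variation of the stochastic heat equation observed at a fixed spatial
point `x ∈ (0,π)` on the uniform time grid of `[c,d]`. -/
theorem stmt14 {Ω : Type*} [MeasurableSpace Ω] (P : Measure Ω) [IsProbabilityMeasure P]
    (θ σ x c d : ℝ) (hθ : 0 < θ) (hσ : 0 < σ) (hx : x ∈ Set.Ioo 0 π)
    (hc : 0 < c) (hcd : c < d)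
    (u : ℝ → Ω → ℝ)
    (hu : IsCenteredGaussianField P u (Set.Icc c d) (heatCovTime θ σ x)) :
    TendstoInMeasure P
      (fun (n : ℕ) ω => Real.sqrt ((θ * π / (3 * (d - c))) * ∑ i ∈ Finset.range n,
        (u (c + (d - c) * ((i : ℝ) + 1) / (n : ℝ)) ω
          - u (c + (d - c) * (i : ℝ) / (n : ℝ)) ω) ^ 4))
      atTop (fun _ => σ ^ 2) := by
  have hsx : 0 < Real.sin x := Real.sin_pos_of_pos_of_lt_pi hx.1 hx.2
  obtain ⟨K, hK, hV⟩ := exists_abs_incrementCov_heatCovTime_sub_le σ hθ hsx hc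
  have hθπ : 0 < θ * π := by positivity
  set C := heatCovTime θ σ x with hCdef
  have hC : ∀ s t, C s t = C t s := heatCovTime_comm θ σ x
  set β := σ ^ 2 / √(θ * π) with hβdef
  have hβ : 0 ≤ β := by positivity
  have hβ2 : β ^ 2 = σ ^ 4 / (θ * π) := by
    rw [hβdef, div_pow, Real.sq_sqrt hθπ.le, ← pow_mul]
  set L := d - c with hLdef
  have hL : 0 < L := sub_pos.2 hcd
  set α := θ * π / (3 * L) with hαdef
  have hα : 0 ≤ α := by positivity
  have hαβ : α * (3 * β ^ 2 * L) = (σ ^ 2) ^ 2 := by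
    rw [hβ2, hαdef]
    field_simp
  set R : ℝ → ℝ := fun r => 2 * α ^ 2 * (192 * L * r ^ 2 * (β + K * r) ^ 4 +
    (3 * L * K * r * (2 * β + K * r)) ^ 2) with hRdef
  have hr0 : Tendsto (fun n : ℕ => √(L / n)) atTop (nhds 0) := by
    have := (tendsto_const_div_atTop_nhds_zero_nat L).sqrt
    rwa [Real.sqrt_zero] at this
  have hR0 : Tendsto (fun n : ℕ => R (√(L / n))) atTop (nhds 0) := by
    have hRc : Continuous R := by fun_prop
    have hR00 : R 0 = 0 := by simp [hRdef]
    have := (hRc.tendsto 0).comp hr0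
    rwa [hR00] at this
  refine tendstoInMeasure_sqrt_of_sq_sub_le (by positivity)
    (fun n ω => mul_nonneg hα (Finset.sum_nonneg fun i _ => by positivity)) hR0 ?_
  filter_upwards [eventually_gt_atTop 0] with n hn
  have hn' : (0 : ℝ) < n := by exact_mod_cast hn
  set h := L / n with hhdef
  have hh : 0 < h := by positivity
  have hnh : n * h = L := by rw [hhdef]; field_simp
  set r := √h with hrdef
  have hr : 0 ≤ r := Real.sqrt_nonneg _
  have hr2 : r ^ 2 = h := Real.sq_sqrt hh.le
  set τ : ℕ → ℝ := fun i => c + L * (i : ℝ) / n with hτ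
  have hτ1 : ∀ i : ℕ, c + L * ((i : ℝ) + 1) / n = τ i + h := by
    intro i
    simp only [hτ, hhdef]
    ring
  have hτc : ∀ i, c ≤ τ i := fun i => le_add_of_nonneg_right (by positivity)
  have hτmem : ∀ i < n, τ i ∈ Set.Icc c d ∧ τ i + h ∈ Set.Icc c d := by
    intro i hi
    have hi' : (i : ℝ) + 1 ≤ n := by exact_mod_cast hi
    have : τ i + h ≤ d := by
      rw [← hτ1, mul_div_assoc]
      have : L * (((i : ℝ) + 1) / n) ≤ L * 1 := by
        gcongr
        exact (div_le_one hn').2 hi'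
      linarith
    exact ⟨⟨hτc i, by linarith⟩, ⟨by linarith [hτc i], this⟩⟩
  have hτlt : ∀ i j, i < j → τ i + h ≤ τ j := by
    intro i j hij
    have : (i : ℝ) + 1 ≤ j := by exact_mod_cast hij
    rw [← hτ1]
    simp only [hτ]
    gcongr
  simp only [hτ1]
  set X : ℕ → Ω → ℝ := fun i ω => u (τ i + h) ω - u (τ i) ω with hX
  have hVar : ∀ i < n, ∫ ω, X i ω ^ 2 ∂P = max (incrementCov C (τ i) (τ i + h) (τ i) (τ i + h)) 0 :=
    fun i hi => hu.integral_sq_increment hC (hτmem i hi).1 (hτmem i hi).2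
  have hVr : ∀ i < n, |∫ ω, X i ω ^ 2 ∂P - β * r| ≤ K * r ^ 2 := by
    intro i hi
    rw [hVar i hi, hr2]
    refine le_trans ?_ (hV (τ i) h (hτc i) hh.le)
    have := abs_max_sub_max_le_abs (incrementCov C (τ i) (τ i + h) (τ i) (τ i + h)) (β * r) 0
    rwa [max_eq_left (by positivity : 0 ≤ β * r)] at this
  have hB : ∀ i ∈ Finset.range n, ∫ ω, X i ω ^ 2 ∂P ≤ r * (β + K * r) := by
    intro i hi
    have := (abs_le.1 (hVr i (Finset.mem_range.1 hi))).2
    nlinarith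
  have hneg : ∀ i ∈ Finset.range n, ∀ j ∈ Finset.range n, i ≠ j →
      ∫ ω, X i ω * X j ω ∂P ≤ 0 := by
    have key : ∀ i < n, ∀ j < n, i < j → ∫ ω, X i ω * X j ω ∂P ≤ 0 := fun i hi j hj hij =>
      hu.integral_increment_mul_increment_nonpos hC (hτmem i hi).1 (hτmem i hi).2
        (hτmem j hj).1 (hτmem j hj).2 (incrementCov_heatCovTime_nonpos σ x hθ
          (hc.le.trans (hτc i)) hh.le (hτlt i j hij))
    intro i hi j hj hij
    rw [Finset.mem_range] at hi hj
    rcases lt_or_gt_of_ne hij with hlt | hlt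
    · exact key i hi j hj hlt
    · simpa only [mul_comm] using key j hj i hi hlt
  obtain ⟨hTi, hT⟩ := integral_sq_sum_pow_four_sub_le (P := P) (Finset.range n)
    (fun i hi j hj => hu.isCenteredGaussianPair_increments hC
      (hτmem i (Finset.mem_range.1 hi)).1 (hτmem i (Finset.mem_range.1 hi)).2
      (hτmem j (Finset.mem_range.1 hj)).1 (hτmem j (Finset.mem_range.1 hj)).2)
    hneg hB (by positivity)
  have hM := abs_sum_sq_sub_le (V := fun i => ∫ ω, X i ω ^ 2 ∂P) hβ hK hr (by rw [hr2, hnh]) hVr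
  set e := ∑ i ∈ Finset.range n, 3 * (∫ ω, X i ω ^ 2 ∂P) ^ 2 - 3 * β ^ 2 * L with hedef
  set T : Ω → ℝ := fun ω =>
    ∑ i ∈ Finset.range n, (X i ω ^ 4 - 3 * (∫ ω, X i ω ^ 2 ∂P) ^ 2) with hTdef
  refine ⟨fun ω => 2 * α ^ 2 * (T ω ^ 2 + e ^ 2),
    (hTi.add (integrable_const (e ^ 2))).const_mul (2 * α ^ 2), fun ω => ?_, ?_⟩
  · have : α * ∑ i ∈ Finset.range n, X i ω ^ 4 - (σ ^ 2) ^ 2 = α * (T ω + e) := by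
      rw [← hαβ, hTdef, hedef]
      simp only [Finset.sum_sub_distrib]
      ring
    rw [this, mul_pow]
    linarith [mul_le_mul_of_nonneg_left (add_sq_le (a := T ω) (b := e)) (sq_nonneg α)]
  · rw [integral_const_mul, integral_add hTi (integrable_const _), integral_const, probReal_univ,
      one_smul]
    have h1 : e ^ 2 ≤ (3 * L * K * r * (2 * β + K * r)) ^ 2 := by
      rw [← sq_abs e]
      exact pow_le_pow_left₀ (abs_nonneg _) hM 2
    have h2 : 192 * ((Finset.range n).card : ℝ) * (r * (β + K * r)) ^ 4 =
        192 * L * r ^ 2 * (β + K * r) ^ 4 := by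
      rw [Finset.card_range, ← hnh, ← hr2]
      ring
    rw [h2] at hT
    exact mul_le_mul_of_nonneg_left (add_le_add hT h1) (by positivity)
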